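/- Let Ω ⊆ ℂ^𝗀 be a domain (nonempty open connected set) and let k, ℓ be positive kernels on Ω that are holomorphic kernels and are not identically zero. Then (k, ℓ) has a Shimorin certificate if and only if it has a strong Shimorin certificate, and in this case k(z,w) ≠ 0 for all z, w ∈ Ω. -/

import Mathlib

open Matrix
open scoped ComplexOrder

noncomputable section

/-- `k` is a positive (semi-definite) kernel on `X`: every Gram sum is a nonnegative real
(using the partial order on `ℂ`, so `0 ≤ w` means `w` is real and nonnegative). -/
def IsPosKernel {X : Type*} (k : X → X → ℂ) : Prop :=
  ∀ (n : ℕ) (z : Fin n → X) (c : Fin n → ℂ),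
    0 ≤ ∑ i, ∑ j, (starRingEnd ℂ) (c i) * c j * k (z i) (z j)

/-- Positive semidefiniteness of the block matrix `[ℓ(z i, z j)·I − k(z i, z j)·W i (W j)ᴴ]`. -/
def PickBlockPSD {X : Type*} (k ℓ : X → X → ℂ) {n N : ℕ}
    (z : Fin n → X) (W : Fin n → Matrix (Fin N) (Fin N) ℂ) : Prop :=
  ∀ u : Fin n → (Fin N → ℂ),
    0 ≤ ∑ i, ∑ j,
      star (u i) ⬝ᵥ ((ℓ (z i) (z j) • (1 : Matrix (Fin N) (Fin N) ℂ)
        - k (z i) (z j) • (W i * (W j)ᴴ)) *ᵥ u j)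

/-- `Φ` is a contractive multiplier from `k` to `ℓ`. -/
def IsContractiveMultiplier {X : Type*} (k ℓ : X → X → ℂ) {N : ℕ}
    (Φ : X → Matrix (Fin N) (Fin N) ℂ) : Prop :=
  ∀ (n : ℕ) (z : Fin n → X), PickBlockPSD k ℓ z fun i => Φ (z i)

/-- `(k, ℓ)` is a complete Pick pair. -/
def IsCompletePickPair {X : Type*} (k ℓ : X → X → ℂ) : Prop :=
  ∀ (n N : ℕ), 1 ≤ n → 1 ≤ N →
    ∀ (z : Fin n → X) (W : Fin n → Matrix (Fin N) (Fin N) ℂ),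
      PickBlockPSD k ℓ z W →
      ∃ Φ : X → Matrix (Fin N) (Fin N) ℂ,
        IsContractiveMultiplier k ℓ Φ ∧ ∀ i, Φ (z i) = W i

/-- The kernel `ℓ^z (w, v) = ℓ(w,v) − ℓ(w,z)·ℓ(z,v)/ℓ(z,z)` of the subspace of functions
vanishing at `z`. -/
def kerShift {X : Type*} (ℓ : X → X → ℂ) (z : X) (w v : X) : ℂ :=
  ℓ w v - ℓ w z * ℓ z v / ℓ z z

/-- A Shimorin certificate for `(k, ℓ)`: a family `p[z]` of positive kernels with
`ℓ^z ⪰ p[z]·ℓ` and `p[z]·k ⪰ k^z` for every `z`. -/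
def IsShimorinCertificate {X : Type*} (k ℓ : X → X → ℂ) (p : X → X → X → ℂ) : Prop :=
  ∀ z : X, IsPosKernel (p z) ∧
    IsPosKernel (fun w v => kerShift ℓ z w v - p z w v * ℓ w v) ∧
    IsPosKernel (fun w v => p z w v * k w v - kerShift k z w v)

/-- `s` is a strong Shimorin certificate for the pair `(k, ℓ)`. -/
def IsStrongShimorinCertificate {X : Type*} (k ℓ s : X → X → ℂ) : Prop :=
  IsPosKernel s ∧ IsCompletePickPair s s ∧
    ∃ h g : X → X → ℂ, IsPosKernel h ∧ IsPosKernel g ∧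
      (∀ z w, k z w = (1 - h z w) * s z w) ∧ (∀ z w, ℓ z w = s z w * g z w)

lemma psd_of_nonneg {ι : Type*} [Fintype ι] (M : Matrix ι ι ℂ)
    (h : ∀ x : ι → ℂ, 0 ≤ ∑ i, ∑ j, (starRingEnd ℂ) (x i) * x j * M i j) : M.PosSemidef := by
  classical
  rw [← Matrix.isPositive_toEuclideanLin_iff, LinearMap.isPositive_iff_complex]
  intro x
  have h1 : 0 ≤ inner ℂ (M.toEuclideanLin x) x := by
    have h2 : inner ℂ x (M.toEuclideanLin x) =
        ∑ i, ∑ j, (starRingEnd ℂ) (x i) * x j * M i j := by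
      rw [EuclideanSpace.inner_eq_star_dotProduct]
      simp only [Matrix.ofLp_toLpLin, Matrix.toLin'_apply, dotProduct, mulVec, Finset.sum_mul,
        Pi.star_apply, RCLike.star_def]
      refine Finset.sum_congr rfl fun i _ => Finset.sum_congr rfl fun j _ => by ring
    have h3 := h x
    rw [← h2] at h3
    rw [← inner_conj_symm]
    exact star_nonneg_iff.mpr h3
  rw [Complex.le_def] at h1
  refine ⟨?_, by simpa using h1.1⟩
  apply Complex.ext <;> simp
  simpa using h1.2

lemma psd_nonneg {ι : Type*} [Fintype ι] {M : Matrix ι ι ℂ} (h : M.PosSemidef) (x : ι → ℂ) :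
    0 ≤ ∑ i, ∑ j, (starRingEnd ℂ) (x i) * x j * M i j := by
  have := h.dotProduct_mulVec_nonneg x
  simp only [dotProduct, mulVec, Finset.mul_sum, Pi.star_apply, RCLike.star_def] at this
  refine this.trans_eq (Finset.sum_congr rfl fun i _ => Finset.sum_congr rfl fun j _ => by ring)

lemma psd_gram {ι : Type*} [Finite ι] {M : Matrix ι ι ℂ} (h : M.PosSemidef) :
    ∃ (m : ℕ) (B : ι → Fin m → ℂ), ∀ i j, M i j = ∑ a, B i a * (starRingEnd ℂ) (B j a) := by
  obtain ⟨m, v, hv⟩ := Matrix.posSemidef_iff_eq_sum_vecMulVec.mp h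
  refine ⟨m, fun i a => v a i, fun i j => ?_⟩
  rw [hv, Matrix.sum_apply]
  rfl

lemma psd_of_gram {ι κ : Type*} [Fintype ι] [Fintype κ] {M : Matrix ι ι ℂ} (B : ι → κ → ℂ)
    (hB : ∀ i j, M i j = ∑ a, B i a * (starRingEnd ℂ) (B j a)) : M.PosSemidef := by
  have : M = (Matrix.of B) * (Matrix.of B)ᴴ := by
    ext i j
    rw [hB]; rfl
  rw [this]
  exact Matrix.posSemidef_self_mul_conjTranspose _

namespace IsPosKernel
variable {X : Type*} {k k' : X → X → ℂ}

lemma psdFin (h : IsPosKernel k) {n : ℕ} (z : Fin n → X) :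
    (Matrix.of fun i j => k (z i) (z j)).PosSemidef :=
  psd_of_nonneg _ (fun x => h n z x)

lemma of_psd (h : ∀ (n : ℕ) (z : Fin n → X), (Matrix.of fun i j => k (z i) (z j)).PosSemidef) :
    IsPosKernel k := fun n z c => psd_nonneg (h n z) c

lemma psd (h : IsPosKernel k) {ι : Type*} [Fintype ι] (z : ι → X) :
    (Matrix.of fun i j => k (z i) (z j)).PosSemidef := by
  have := (h.psdFin (z ∘ (Fintype.equivFin ι).symm)).submatrix (Fintype.equivFin ι)
  convert this using 1
  ext i j
  simp

lemma gram (h : IsPosKernel k) {ι : Type*} [Fintype ι] (z : ι → X) :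
    ∃ (m : ℕ) (B : ι → Fin m → ℂ),
      ∀ i j, k (z i) (z j) = ∑ a, B i a * (starRingEnd ℂ) (B j a) := psd_gram (h.psd z)

lemma of_gram {κ : Type*} [Fintype κ] (B : X → κ → ℂ)
    (hB : ∀ i j, k i j = ∑ a, B i a * (starRingEnd ℂ) (B j a)) : IsPosKernel k :=
  of_psd fun _ z => psd_of_gram (fun i a => B (z i) a) (fun i j => hB (z i) (z j))

lemma congr (h : IsPosKernel k) (e : ∀ x y, k' x y = k x y) : IsPosKernel k' := by
  have : k' = k := by ext x y; exact e x y
  rwa [this]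

lemma herm (h : IsPosKernel k) (x y : X) : k y x = (starRingEnd ℂ) (k x y) := by
  obtain ⟨m, B, hB⟩ := h.gram ![x, y]
  have h1 := hB 0 1
  have h2 := hB 1 0
  simp only [Matrix.cons_val_zero, Matrix.cons_val_one] at h1 h2
  rw [h1, h2, map_sum]
  exact Finset.sum_congr rfl fun a _ => by simp [mul_comm]

lemma diag (h : IsPosKernel k) (x : X) : 0 ≤ k x x := by
  simpa using (h.psdFin ![x]).diag_nonneg (i := 0)

lemma add (h : IsPosKernel k) (h' : IsPosKernel k') : IsPosKernel fun x y => k x y + k' x y :=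
  of_psd fun _ z => (h.psdFin z).add (h'.psdFin z)

lemma mul (h : IsPosKernel k) (h' : IsPosKernel k') : IsPosKernel fun x y => k x y * k' x y :=
  of_psd fun _ z => (h.psdFin z).hadamard (h'.psdFin z)

lemma rankOne (f : X → ℂ) : IsPosKernel fun x y => f x * (starRingEnd ℂ) (f y) :=
  of_gram (fun x (_ : Unit) => f x) (by simp)

lemma scale (h : IsPosKernel k) (f : X → ℂ) :
    IsPosKernel fun x y => f x * (starRingEnd ℂ) (f y) * k x y := (rankOne f).mul h

lemma const {c : ℂ} (hc : 0 ≤ c) : IsPosKernel fun _ _ : X => c :=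
  of_gram (fun _ (_ : Unit) => (Real.sqrt c.re : ℂ)) (by
    intro _ _
    have h1 : c = (c.re : ℂ) := by
      apply Complex.ext
      · simp
      · simpa using (Complex.le_def.mp hc).2.symm
    have h2 : 0 ≤ c.re := by simpa using (Complex.le_def.mp hc).1
    simp only [Finset.univ_unique, Complex.conj_ofReal, Finset.sum_const, Finset.card_singleton,
      one_smul, ← Complex.ofReal_mul, Real.mul_self_sqrt h2]
    exact h1)

lemma shift (h : IsPosKernel k) (z : X) (c : X → ℂ) :
    IsPosKernel fun x y => k x y - c x * k z y - (starRingEnd ℂ) (c y) * k x z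
      + c x * (starRingEnd ℂ) (c y) * k z z := by
  refine of_psd fun n x => ?_
  obtain ⟨m, B, hB⟩ := h.gram (fun o : Option (Fin n) => o.elim z x)
  refine psd_of_gram (fun i a => B (some i) a - c (x i) * B none a) fun i j => ?_
  have h1 := hB (some i) (some j)
  have h2 := hB (some i) none
  have h3 := hB none (some j)
  have h4 := hB none none
  simp only [Option.elim] at h1 h2 h3 h4
  simp only [Matrix.of_apply, h1, h2, h3, h4, Finset.mul_sum, ← Finset.sum_sub_distrib,
    ← Finset.sum_add_distrib, map_sub, map_mul]
  exact Finset.sum_congr rfl fun a _ => by ring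

lemma kerShift (h : IsPosKernel k) (z : X) : IsPosKernel (kerShift k z) := by
  by_cases hz : k z z = 0
  · exact h.congr fun x y => by simp [_root_.kerShift, hz]
  · refine (h.shift z fun x => k x z / k z z).congr fun x y => ?_
    have h1 := h.herm y z
    have h2 := h.herm z z
    simp only [_root_.kerShift, map_div₀, ← h2, ← h1]
    field_simp
    ring

lemma cs (h : IsPosKernel k) (x y : X) : k x y * k y x ≤ k x x * k y y := by
  have h0 := h.diag y
  rcases eq_or_lt_of_le h0 with h1 | h1
  · obtain ⟨m, B, hB⟩ := h.gram ![x, y]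
    have hyy := hB 1 1
    have hxy := hB 0 1
    simp only [Matrix.cons_val_zero, Matrix.cons_val_one] at hyy hxy
    have hz : ∀ a, B 1 a = 0 := by
      rw [← h1] at hyy
      have := (Finset.sum_eq_zero_iff_of_nonneg (fun a _ => by
        simpa using mul_star_self_nonneg (B 1 a))).mp hyy.symm
      intro a
      simpa using this a (Finset.mem_univ _)
    have : k x y = 0 := by rw [hxy]; simp [hz]
    simp [this, ← h1]
  · have h2 := (h.kerShift y).diag x
    simp only [_root_.kerShift, sub_nonneg] at h2
    rwa [div_le_iff₀ h1] at h2

lemma zero_of_diag (h : IsPosKernel k) {x : X} (hx : k x x = 0) (y : X) : k x y = 0 := by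
  have h1 := h.cs x y
  rw [hx, zero_mul, h.herm x y] at h1
  have h2 := mul_star_self_nonneg (k x y)
  have h3 : k x y * (starRingEnd ℂ) (k x y) = 0 := le_antisymm h1 h2
  simpa using h3

lemma norm_cs (h : IsPosKernel k) (x y : X) : ‖k x y‖ ^ 2 ≤ (k x x).re * (k y y).re := by
  have h1 := h.cs x y
  rw [h.herm x y, Complex.mul_conj] at h1
  have h3 := (Complex.le_def.mp h1).1
  have h2 := (Complex.le_def.mp (h.diag x)).2
  rw [Complex.normSq_eq_norm_sq, Complex.ofReal_re] at h3
  simpa [← h2] using h3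

lemma norm_lt (h : IsPosKernel k) {x y : X} (hx : k x x < 1) (hy : k y y ≤ 1) : ‖k x y‖ < 1 := by
  have h1 := h.norm_cs x y
  have hx0 := (Complex.le_def.mp (h.diag x)).1
  have hy0 := (Complex.le_def.mp (h.diag y)).1
  have hx1 := (Complex.lt_def.mp hx).1
  have hy1 := (Complex.le_def.mp hy).1
  simp at hx0 hy0 hx1 hy1
  have : ‖k x y‖ ^ 2 < 1 := by nlinarith
  nlinarith [norm_nonneg (k x y)]

lemma one_sub_ne (h : IsPosKernel k) {x y : X} (hx : k x x < 1) (hy : k y y ≤ 1) :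
    1 - k x y ≠ 0 := by
  intro h0
  have h1 := h.norm_lt hx hy
  rw [← sub_eq_zero.mp h0] at h1
  simp at h1

/-- The key identity behind ball automorphisms. -/
lemma mobius (h : IsPosKernel k) {z : X} (hz : k z z < 1) :
    IsPosKernel fun x y => (1 - k x z) * (1 - k z y) / (1 - k z z) - 1 + k x y := by
  have h1z : (1 - k z z) ≠ 0 := h.one_sub_ne hz hz.le
  by_cases h0 : k z z = 0
  · refine h.congr fun x y => ?_
    have h1 : k z y = 0 := h.zero_of_diag h0 y
    have h2 : k x z = 0 := by rw [h.herm z x, h.zero_of_diag h0 x]; simp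
    simp [h0, h1, h2]
  · have hz0 : 0 < k z z := lt_of_le_of_ne (h.diag z) (Ne.symm h0)
    have hc : 0 ≤ 1 / (k z z * (1 - k z z)) := by
      have h2 : 0 < 1 - k z z := sub_pos.mpr hz
      have h3 := mul_pos hz0 h2
      rw [one_div]
      exact (RCLike.inv_pos_of_pos h3).le
    refine ((h.kerShift z).add ((const hc).mul (rankOne fun x => k x z - k z z))).congr
      fun x y => ?_
    have e1 := h.herm y z
    have e2 := h.herm z z
    simp only [_root_.kerShift, map_sub, ← e1, ← e2]
    field_simp
    ring

lemma pow (h : IsPosKernel k) (n : ℕ) : IsPosKernel fun x y => k x y ^ n := by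
  induction n with
  | zero => exact (const (c := 1) zero_le_one).congr fun x y => by simp
  | succ n ih => exact (ih.mul h).congr fun x y => by rw [pow_succ]

lemma geom (h : IsPosKernel k) (hk : ∀ x, k x x < 1) : IsPosKernel fun x y => (1 - k x y)⁻¹ := by
  have hsum : ∀ N : ℕ, IsPosKernel fun x y => ∑ n ∈ Finset.range N, k x y ^ n := by
    intro N
    induction N with
    | zero => exact (const (c := 0) le_rfl).congr fun x y => by simp
    | succ n ih => exact (ih.add (h.pow n)).congr fun x y => by rw [Finset.sum_range_succ]
  intro n z c
  have hl : Filter.Tendsto (fun N : ℕ => ∑ i, ∑ j, (starRingEnd ℂ) (c i) * c j *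
      ∑ m ∈ Finset.range N, k (z i) (z j) ^ m) Filter.atTop
      (nhds (∑ i, ∑ j, (starRingEnd ℂ) (c i) * c j * (1 - k (z i) (z j))⁻¹)) := by
    refine tendsto_finsetSum _ fun i _ => tendsto_finsetSum _ fun j _ => ?_
    exact ((hasSum_geometric_of_norm_lt_one
      (h.norm_lt (hk (z i)) (hk (z j)).le)).tendsto_sum_nat).const_mul _
  exact ge_of_tendsto' hl fun N => hsum N n z c

end IsPosKernel

lemma psd_congr {ι : Type*} {M M' : Matrix ι ι ℂ} (h : M.PosSemidef)
    (e : ∀ i j, M' i j = M i j) : M'.PosSemidef := by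
  have : M' = M := by ext i j; exact e i j
  rwa [this]

/-- The block matrix of a Pick problem. -/
def blockM {X ι : Type*} {N : ℕ} (k ℓ : X → X → ℂ) (z : ι → X)
    (W : ι → Matrix (Fin N) (Fin N) ℂ) : Matrix (ι × Fin N) (ι × Fin N) ℂ :=
  Matrix.of fun p q => ℓ (z p.1) (z q.1) * (if p.2 = q.2 then 1 else 0)
    - k (z p.1) (z q.1) * ∑ c, W p.1 p.2 c * (starRingEnd ℂ) (W q.1 q.2 c)

lemma block_quad {X : Type*} {n N : ℕ} (k ℓ : X → X → ℂ) (z : Fin n → X)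
    (W : Fin n → Matrix (Fin N) (Fin N) ℂ) (u : Fin n → Fin N → ℂ) :
    (∑ i, ∑ j,
      star (u i) ⬝ᵥ ((ℓ (z i) (z j) • (1 : Matrix (Fin N) (Fin N) ℂ)
        - k (z i) (z j) • (W i * (W j)ᴴ)) *ᵥ u j)) =
    ∑ p : Fin n × Fin N, ∑ q : Fin n × Fin N,
      (starRingEnd ℂ) (u p.1 p.2) * u q.1 q.2 * blockM k ℓ z W p q := by
  simp only [Fintype.sum_prod_type]
  refine Finset.sum_congr rfl fun i _ => ?_
  rw [Finset.sum_comm]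
  refine Finset.sum_congr rfl fun j _ => ?_
  simp only [dotProduct, mulVec, Finset.mul_sum]
  refine Finset.sum_congr rfl fun a _ => Finset.sum_congr rfl fun b _ => ?_
  simp only [blockM, Matrix.of_apply, Matrix.sub_apply, Matrix.smul_apply, Matrix.one_apply,
    Matrix.mul_apply, Matrix.conjTranspose_apply, smul_eq_mul, Pi.star_apply, RCLike.star_def]
  ring

lemma pickBlockPSD_iff {X : Type*} {n N : ℕ} (k ℓ : X → X → ℂ) (z : Fin n → X)
    (W : Fin n → Matrix (Fin N) (Fin N) ℂ) :
    PickBlockPSD k ℓ z W ↔ (blockM k ℓ z W).PosSemidef := by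
  constructor
  · intro h
    refine psd_of_nonneg _ fun x => ?_
    have := h (fun i a => x (i, a))
    rw [block_quad] at this
    exact this
  · intro h u
    rw [block_quad]
    exact psd_nonneg h fun p => u p.1 p.2

lemma pick_row {X : Type*} {s : X → X → ℂ} (hs : IsPosKernel s) (hP : IsCompletePickPair s s)
    {n N : ℕ} (hn : 1 ≤ n) (z : Fin n → X) (w : Fin n → Fin (N + 1) → ℂ)
    (h : (Matrix.of fun i j => s (z i) (z j) *
      (1 - ∑ c, w i c * (starRingEnd ℂ) (w j c))).PosSemidef) :
    ∃ φ : X → Fin (N + 1) → ℂ, IsPosKernel (fun x y => s x y *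
      (1 - ∑ c, φ x c * (starRingEnd ℂ) (φ y c))) ∧ ∀ i, φ (z i) = w i := by
  obtain ⟨Φ, hΦ, hΦz⟩ := hP n (N + 1) hn (by omega) z
    (fun i => Matrix.of fun a b => if a = 0 then w i b else 0) (by
      rw [pickBlockPSD_iff]
      have h1 := (h.submatrix (Prod.fst : Fin n × Fin (N + 1) → Fin n)).hadamard
        (psd_of_gram (M := Matrix.of fun p q : Fin n × Fin (N + 1) =>
          if p.2 = 0 ∧ q.2 = 0 then (1 : ℂ) else 0)
          (fun p (_ : Unit) => if p.2 = 0 then 1 else 0)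
          (fun p q => by by_cases h1 : p.2 = 0 <;> by_cases h2 : q.2 = 0 <;> simp [h1, h2]))
      have h2 := ((hs.psd z).submatrix (Prod.fst : Fin n × Fin (N + 1) → Fin n)).hadamard
        (psd_of_gram (M := Matrix.of fun p q : Fin n × Fin (N + 1) =>
          if p.2 = q.2 ∧ p.2 ≠ 0 then (1 : ℂ) else 0)
          (fun p (c : Fin (N + 1)) => if p.2 = c ∧ c ≠ 0 then 1 else 0)
          (fun p q => by
            by_cases h2 : p.2 = 0
            · rw [Finset.sum_eq_zero]
              · simp [h2]
              · intro c _
                by_cases h3 : c = 0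
                · simp [h3]
                · simp [h2, Ne.symm h3]
            · rw [Finset.sum_eq_single p.2]
              · simp [h2, eq_comm]
              · intro c _ hc
                simp [Ne.symm hc]
              · simp))
      refine psd_congr (h1.add h2) fun p q => ?_
      by_cases hp : p.2 = 0 <;> by_cases hq : q.2 = 0 <;>
        by_cases hpq : p.2 = q.2 <;>
        simp_all [blockM, mul_sub])
  refine ⟨fun x => Φ x 0, ?_, fun i => ?_⟩
  · refine IsPosKernel.of_psd fun m y => ?_
    have h1 := ((pickBlockPSD_iff _ _ _ _).mp (hΦ m y)).submatrix (fun i => (i, (0 : Fin (N + 1))))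
    convert h1 using 1
    ext i j
    simp [blockM, mul_sub]
  · ext b
    simp [hΦz]

lemma row_shift {X κ : Type*} [Fintype κ] {s : X → X → ℂ} (hs : IsPosKernel s) (z : X)
    (hz : 0 < s z z) (φ : X → κ → ℂ)
    (h : IsPosKernel (fun x y => s x y * (1 - ∑ c, φ x c * (starRingEnd ℂ) (φ y c)))) :
    IsPosKernel (fun x y => kerShift s z x y * (1 - ∑ c, φ x c * (starRingEnd ℂ) (φ y c))) := by
  have hz0 : s z z ≠ 0 := hz.ne'
  have hc : 0 ≤ 1 / s z z := by
    rw [one_div]; exact (RCLike.inv_pos_of_pos hz).le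
  have h1 := h.shift z (fun x => s x z / s z z)
  have h2 : IsPosKernel fun x y => ∑ c, (φ x c - φ z c) * (starRingEnd ℂ) (φ y c - φ z c) :=
    IsPosKernel.of_gram (fun x c => φ x c - φ z c) (fun _ _ => rfl)
  have h3 := (IsPosKernel.const hc).mul (h2.scale (fun x => s x z))
  refine (h1.add h3).congr fun x y => ?_
  have e1 := hs.herm y z
  have e2 := hs.herm z z
  have e3 : ∑ c, (φ x c - φ z c) * (starRingEnd ℂ) (φ y c - φ z c) =
      ∑ c, φ x c * (starRingEnd ℂ) (φ y c) - ∑ c, φ x c * (starRingEnd ℂ) (φ z c)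
      - ∑ c, φ z c * (starRingEnd ℂ) (φ y c) + ∑ c, φ z c * (starRingEnd ℂ) (φ z c) := by
    simp only [← Finset.sum_sub_distrib, ← Finset.sum_add_distrib, map_sub]
    exact Finset.sum_congr rfl fun a _ => by ring
  simp only [kerShift, e3, map_div₀, ← e1, ← e2]
  field_simp
  ring

lemma pick_trans {X : Type*} {s : X → X → ℂ} (hs : IsPosKernel s) (hP : IsCompletePickPair s s)
    (hd : ∀ x, 0 < s x x) {a b c : X} (hab : s a b ≠ 0) (hbc : s b c ≠ 0) : s a c ≠ 0 := by
  intro hac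
  have hca : s c a = 0 := by rw [hs.herm a c, hac]; simp
  obtain ⟨φ, hφ, hφz⟩ := pick_row hs hP (n := 2) (N := 0) (by norm_num) ![a, c]
    ![fun _ => 1, fun _ => -1] (by
      convert (Matrix.PosSemidef.zero : (0 : Matrix (Fin 2) (Fin 2) ℂ).PosSemidef) using 1
      ext i j
      fin_cases i <;> fin_cases j <;> simp [hac, hca])
  have ha := hφz 0
  have hc := hφz 1
  simp only [Matrix.cons_val_zero, Matrix.cons_val_one] at ha hc
  have h1 := (row_shift hs b (hd b) φ hφ).zero_of_diag (x := a) (by simp [ha]) c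
  simp only [kerShift, hac, ha, hc] at h1
  have := (hd b).ne'
  norm_num at h1
  tauto

/-- McCullough–Quiggin, necessity. -/
lemma pick_necessity {X : Type*} {s : X → X → ℂ} (hs : IsPosKernel s)
    (hP : IsCompletePickPair s s) (hd : ∀ x, 0 < s x x) (hne : ∀ x y, s x y ≠ 0) (z : X) :
    IsPosKernel fun x y => 1 - s x z * s z y / (s z z * s x y) := by
  suffices H : ∀ (n : ℕ) (z : X) (x : Fin n → X), (Matrix.of fun i j =>
      1 - s (x i) z * s z (x j) / (s z z * s (x i) (x j))).PosSemidef from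
    IsPosKernel.of_psd fun n x => H n z x
  intro n
  induction n with
  | zero => 
    intro z x
    convert (Matrix.PosSemidef.zero : (0 : Matrix (Fin 0) (Fin 0) ℂ).PosSemidef) using 1
    ext i; exact i.elim0
  | succ n ih =>
    intro z x
    obtain ⟨m, B, hB⟩ := psd_gram (ih (x 0) (fun i => x i.succ))
    let w : Fin (n + 1) → Fin (m + 1) → ℂ := fun i => 
      Fin.cons 0 (Fin.cases (motive := fun _ => Fin m → ℂ) (fun _ => 0) B i)
    have hw : ∀ i j, 1 - ∑ c, w i c * (starRingEnd ℂ) (w j c) =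
        s (x i) (x 0) * s (x 0) (x j) / (s (x 0) (x 0) * s (x i) (x j)) := by
      intro i j
      refine Fin.cases ?_ (fun i => ?_) i
      · have := hne (x 0) (x 0); have := hne (x 0) (x j)
        simp [w, Fin.sum_univ_succ]
        field_simp
      · refine Fin.cases ?_ (fun j => ?_) j
        · have := hne (x 0) (x 0); have := hne (x i.succ) (x 0)
          simp [w, Fin.sum_univ_succ]
          field_simp
        · have := hB i j
          simp only [Matrix.of_apply] at this
          simp only [w, Fin.sum_univ_succ, Fin.cons_zero, Fin.cons_succ, Fin.cases_succ]
          rw [← this]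
          simp
    have hsc : 0 ≤ 1 / s (x 0) (x 0) := by
      rw [one_div]; exact (RCLike.inv_pos_of_pos (hd _)).le
    obtain ⟨φ, hφ, hφz⟩ := pick_row hs hP (by omega) x w (by
      convert ((IsPosKernel.const hsc).mul
        (IsPosKernel.rankOne fun y => s y (x 0))).psd x using 1
      ext i j
      have e := hs.herm (x j) (x 0)
      have := hne (x 0) (x 0); have := hne (x i) (x j)
      simp only [Matrix.of_apply, hw, ← e]
      field_simp)
    have h1 := row_shift hs z (hd z) φ hφ
    have h2 := ((h1.mul (IsPosKernel.const (hd (x 0)).le)).scale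
      (fun y => 1 / s y (x 0))).psd x
    convert h2 using 1
    ext i j
    have e := hs.herm (x j) (x 0)
    have := hne (x 0) (x 0); have := hne (x i) (x j); have := hne z z; have := hne (x i) (x 0)
    have := hne (x 0) (x j)
    simp only [Matrix.of_apply, hφz, hw, kerShift, map_div₀, map_one, ← e]
    field_simp

lemma douglas_lin {V F G : Type*} [NormedAddCommGroup V] [InnerProductSpace ℂ V]
    [NormedAddCommGroup F] [InnerProductSpace ℂ F] [FiniteDimensional ℂ F]
    [NormedAddCommGroup G] [InnerProductSpace ℂ G]
    (f : V →ₗ[ℂ] F) (g : V →ₗ[ℂ] G) (h : ∀ x, ‖g x‖ ≤ ‖f x‖) :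
    ∃ T : F →ₗ[ℂ] G, (∀ x, T (f x) = g x) ∧ ∀ y, ‖T y‖ ≤ ‖y‖ := by
  have hle : LinearMap.ker f ≤ LinearMap.ker g := by
    intro x hx
    rw [LinearMap.mem_ker] at hx ⊢
    have := h x
    rw [hx, norm_zero] at this
    exact norm_le_zero_iff.mp this
  let T₀ : LinearMap.range f →ₗ[ℂ] G :=
    ((LinearMap.ker f).liftQ g hle) ∘ₗ (f.quotKerEquivRange.symm : _ →ₗ[ℂ] _)
  have hT₀ : ∀ x, T₀ ⟨f x, LinearMap.mem_range_self f x⟩ = g x := by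
    intro x
    have : f.quotKerEquivRange.symm ⟨f x, LinearMap.mem_range_self f x⟩ =
        (LinearMap.ker f).mkQ x := f.quotKerEquivRange_symm_apply_image x _
    simp only [T₀, LinearMap.comp_apply, LinearEquiv.coe_coe, this]
    simp
  let P := (LinearMap.range f).orthogonalProjectionOnto
  refine ⟨T₀ ∘ₗ (P : F →ₗ[ℂ] LinearMap.range f), fun x => ?_, fun y => ?_⟩
  · have : P (f x) = ⟨f x, LinearMap.mem_range_self f x⟩ :=
      Submodule.orthogonalProjectionOnto_mem_subspace_eq_self
        (⟨f x, LinearMap.mem_range_self f x⟩ : LinearMap.range f)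
    simp only [LinearMap.comp_apply, ContinuousLinearMap.coe_coe, this, hT₀]
  · obtain ⟨x, hx⟩ := (P y).2
    have h1 : P y = ⟨f x, LinearMap.mem_range_self f x⟩ := Subtype.ext hx.symm
    simp only [LinearMap.comp_apply, ContinuousLinearMap.coe_coe, h1, hT₀]
    refine (h x).trans ?_
    rw [hx]
    exact Submodule.norm_orthogonalProjectionOnto_apply_le _ y

lemma toEuc_inner {α β : Type*} [Fintype α] [Fintype β] [DecidableEq α] [DecidableEq β]
    (A : Matrix α β ℂ) (x : EuclideanSpace ℂ α) (y : EuclideanSpace ℂ β) :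
    inner ℂ (Aᴴ.toEuclideanLin x) y = inner ℂ x (A.toEuclideanLin y) := by
  rw [Matrix.toEuclideanLin_conjTranspose_eq_adjoint, LinearMap.adjoint_inner_left]

lemma toEuc_key {α δ : Type*} [Fintype α] [DecidableEq α] [Fintype δ] [DecidableEq δ]
    (A : Matrix α δ ℂ) (x : EuclideanSpace ℂ α) :
    ((‖Aᴴ.toEuclideanLin x‖ ^ 2 : ℝ) : ℂ) = star x.ofLp ⬝ᵥ ((A * Aᴴ) *ᵥ x.ofLp) := by
  have h1 := inner_self_eq_norm_sq_to_K (𝕜 := ℂ) (Aᴴ.toEuclideanLin x)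
  rw [toEuc_inner, EuclideanSpace.inner_eq_star_dotProduct] at h1
  push_cast
  rw [dotProduct_comm, ← Matrix.mulVec_mulVec]
  exact h1.symm

lemma douglas {α β γ : Type*} [Fintype α] [Fintype β] [Fintype γ] [DecidableEq γ]
    (R : Matrix α β ℂ) (E : Matrix α γ ℂ) (h : (R * Rᴴ - E * Eᴴ).PosSemidef) :
    ∃ K : Matrix β γ ℂ, E = R * K ∧ (1 - Kᴴ * K).PosSemidef := by
  classical
  obtain ⟨T, hT1, hT2⟩ := douglas_lin (Rᴴ.toEuclideanLin) (Eᴴ.toEuclideanLin) (by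
    intro x
    have h1 := h.dotProduct_mulVec_nonneg x.ofLp
    rw [Matrix.sub_mulVec, dotProduct_sub, ← toEuc_key, ← toEuc_key, sub_nonneg, Complex.real_le_real] at h1
    exact (pow_le_pow_iff_left₀ (norm_nonneg _) (norm_nonneg _) two_ne_zero).mp h1)
  obtain ⟨L, rfl⟩ := (Matrix.toEuclideanLin (𝕜 := ℂ) (m := γ) (n := β)).surjective T
  refine ⟨Lᴴ, ?_, ?_⟩
  · have : L * Rᴴ = Eᴴ := by
      apply (Matrix.toEuclideanLin (𝕜 := ℂ)).injective
      ext1 x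
      rw [← hT1]
      apply (WithLp.equiv 2 _).injective
      simp [Matrix.toEuclideanLin, Matrix.mulVec_mulVec]
    rw [← Matrix.conjTranspose_conjTranspose E, ← this]
    simp
  · refine psd_of_nonneg _ fun x => ?_
    have hc : ‖(Lᴴ).toEuclideanLin (WithLp.toLp 2 x)‖ ≤ ‖WithLp.toLp 2 x‖ := by
      set y := WithLp.toLp 2 x
      set v := (Lᴴ).toEuclideanLin y
      have h1 : inner ℂ v v = inner ℂ y (L.toEuclideanLin v) := toEuc_inner L y v
      have h2 : ‖v‖ ^ 2 ≤ ‖y‖ * ‖v‖ := by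
        have h3 : ‖(inner ℂ v v : ℂ)‖ = ‖v‖ ^ 2 := by
          rw [inner_self_eq_norm_sq_to_K]; simp
        rw [← h3, h1]
        exact (norm_inner_le_norm _ _).trans (mul_le_mul_of_nonneg_left (hT2 v) (norm_nonneg _))
      by_contra hlt
      push Not at hlt
      nlinarith [norm_nonneg y, norm_nonneg v]
    have e1 : ((‖(Lᴴ).toEuclideanLin (WithLp.toLp 2 x)‖ ^ 2 : ℝ) : ℂ) =
        star x ⬝ᵥ ((L * Lᴴ) *ᵥ x) := by
      have h1 := inner_self_eq_norm_sq_to_K (𝕜 := ℂ) (Lᴴ.toEuclideanLin (WithLp.toLp 2 x))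
      rw [toEuc_inner, EuclideanSpace.inner_eq_star_dotProduct] at h1
      push_cast
      rw [dotProduct_comm, ← Matrix.mulVec_mulVec]
      exact h1.symm
    have e2 : ((‖(WithLp.toLp 2 x : EuclideanSpace ℂ γ)‖ ^ 2 : ℝ) : ℂ) = star x ⬝ᵥ x := by
      have h1 := inner_self_eq_norm_sq_to_K (𝕜 := ℂ) (WithLp.toLp 2 x : EuclideanSpace ℂ γ)
      rw [EuclideanSpace.inner_eq_star_dotProduct] at h1
      push_cast
      rw [dotProduct_comm]
      exact h1.symm
    have e3 : 0 ≤ star x ⬝ᵥ ((1 - Lᴴᴴ * Lᴴ) *ᵥ x) := by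
      rw [Matrix.sub_mulVec, dotProduct_sub, Matrix.one_mulVec, Matrix.conjTranspose_conjTranspose,
        ← e1, ← e2, sub_nonneg, Complex.real_le_real]
      exact pow_le_pow_left₀ (norm_nonneg _) hc 2
    refine e3.trans_eq ?_
    simp only [dotProduct, mulVec, Finset.mul_sum, Pi.star_apply, RCLike.star_def]
    exact Finset.sum_congr rfl fun i _ => Finset.sum_congr rfl fun j _ => by ring

lemma one_point {X : Type*} {s : X → X → ℂ} (hs : IsPosKernel s) (hd : ∀ x, 0 < s x x)
    (hne : ∀ x y, s x y ≠ 0) (z : X)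
    (hF : IsPosKernel fun x y => 1 - s x z * s z y / (s z z * s x y))
    {ι : Type*} [Fintype ι] {N : ℕ} (x : ι → X) (W : ι → Matrix (Fin N) (Fin N) ℂ)
    (h : (blockM s s x W).PosSemidef) :
    ∃ T : Matrix (Fin N) (Fin N) ℂ,
      (blockM s s (fun o : Option ι => o.elim z x) (fun o => o.elim T W)).PosSemidef := by
  classical
  obtain ⟨m, B, hB⟩ := psd_gram h
  obtain ⟨r, hr0, hr⟩ : ∃ r : ℝ, r ≠ 0 ∧ s z z = (r : ℂ) * r := by
    have h1 := Complex.lt_def.mp (hd z)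
    simp only [Complex.zero_re, Complex.zero_im] at h1
    refine ⟨Real.sqrt (s z z).re, (Real.sqrt_pos.mpr h1.1).ne', ?_⟩
    rw [← Complex.ofReal_mul, Real.mul_self_sqrt h1.1.le]
    apply Complex.ext
    · simp
    · simp [← h1.2]
  have hr0' : (r : ℂ) ≠ 0 := by exact_mod_cast hr0
  let R : Matrix (ι × Fin N) (Fin m ⊕ Fin N) ℂ := Matrix.of fun p =>
    Sum.elim (B p) (fun c => s (x p.1) z / r * W p.1 p.2 c)
  let E : Matrix (ι × Fin N) (Fin N) ℂ := Matrix.of fun p b =>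
    s (x p.1) z / r * (if p.2 = b then 1 else 0)
  have hpsd : (R * Rᴴ - E * Eᴴ).PosSemidef := by
    have h1 := h.hadamard ((hF.psd x).submatrix (Prod.fst : ι × Fin N → ι))
    refine psd_congr h1 fun p q => ?_
    have hb := hB p q
    have e1 : ∑ c, (if p.2 = c then (1 : ℂ) else 0) * (if q.2 = c then (1 : ℂ) else 0)
        = if p.2 = q.2 then 1 else 0 := by
      simp [eq_comm]
    have e2 : (E * Eᴴ) p q = s (x p.1) z * s z (x q.1) / s z z * (if p.2 = q.2 then 1 else 0) := by
      rw [← e1, Matrix.mul_apply, Finset.mul_sum]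
      refine Finset.sum_congr rfl fun c _ => ?_
      have h3 := hs.herm (x q.1) z
      simp only [E, Matrix.of_apply, Matrix.conjTranspose_apply, RCLike.star_def, map_mul,
        map_div₀, Complex.conj_ofReal, ← h3, hr]
      by_cases h4 : p.2 = c <;> by_cases h5 : q.2 = c <;> simp [h4, h5]
      field_simp
    have e3 : (R * Rᴴ) p q = blockM s s x W p q + s (x p.1) z * s z (x q.1) / s z z *
        ∑ c, W p.1 p.2 c * (starRingEnd ℂ) (W q.1 q.2 c) := by
      rw [Matrix.mul_apply, Fintype.sum_sum_type, hb, Finset.mul_sum]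
      congr 1
      refine Finset.sum_congr rfl fun c _ => ?_
      have h3 := hs.herm (x q.1) z
      simp only [R, Matrix.of_apply, Matrix.conjTranspose_apply, RCLike.star_def, map_mul,
        map_div₀, Complex.conj_ofReal, ← h3, hr, Sum.elim_inr]
      field_simp
    rw [Matrix.sub_apply, e2, e3]
    have n1 := hne (x p.1) (x q.1)
    have n2 := hne z z
    simp only [blockM, Matrix.of_apply, Matrix.hadamard_apply, Matrix.submatrix_apply]
    field_simp
    ring
  obtain ⟨K, hK, hKc⟩ := douglas R E hpsd
  obtain ⟨m', Q, hQ⟩ := psd_gram hKc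
  have hK1 : ∀ i a b, (r : ℂ) * ∑ c, B (i, a) c * K (Sum.inl c) b = s (x i) z *
      ((if a = b then 1 else 0) - ∑ c, W i a c * K (Sum.inr c) b) := by
    intro i a b
    have h1 := congrFun (congrFun hK (i, a)) b
    rw [Matrix.mul_apply, Fintype.sum_sum_type] at h1
    simp only [E, R, Matrix.of_apply, Sum.elim_inl, Sum.elim_inr] at h1
    simp only [mul_assoc (s (x i) z / (r : ℂ)), ← Finset.mul_sum] at h1
    rw [← sub_eq_iff_eq_add] at h1
    rw [← h1]
    field_simp
  have hK2 : ∀ j a b, (r : ℂ) * ∑ c, (starRingEnd ℂ) (B (j, b) c) *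
      (starRingEnd ℂ) (K (Sum.inl c) a) = s z (x j) *
      ((if a = b then 1 else 0) - ∑ c, (starRingEnd ℂ) (W j b c) *
        (starRingEnd ℂ) (K (Sum.inr c) a)) := by
    intro j a b
    have h1 := congrArg (starRingEnd ℂ) (hK1 j b a)
    simp only [map_mul, map_sub, map_sum, Complex.conj_ofReal, ← hs.herm (x j) z] at h1
    rw [h1]
    congr 2
    by_cases hab : a = b <;> simp [hab, eq_comm]
  refine ⟨Matrix.of fun a c => (starRingEnd ℂ) (K (Sum.inr c) a), ?_⟩
  refine psd_of_gram (fun p : Option ι × Fin N => p.1.elim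
    (Sum.elim (fun c => r * (starRingEnd ℂ) (K (Sum.inl c) p.2)) (fun e => r * Q p.2 e))
    (fun i => Sum.elim (B (i, p.2)) (fun _ : Fin m' => 0))) ?_
  rintro ⟨o, a⟩ ⟨o', b⟩
  rw [Fintype.sum_sum_type]
  rcases o with _ | i <;> rcases o' with _ | j
  · have h1 := hQ a b
    rw [Matrix.sub_apply, Matrix.mul_apply, Fintype.sum_sum_type, Matrix.one_apply] at h1
    simp only [Matrix.conjTranspose_apply, RCLike.star_def] at h1
    simp only [blockM, Matrix.of_apply, Option.elim, Sum.elim_inl, Sum.elim_inr, map_mul,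
      Complex.conj_ofReal, Complex.conj_conj]
    have h2 : ∀ A B : ℂ, (r : ℂ) * A * (r * B) = r * r * (A * B) := fun A B => by ring
    simp only [h2, ← Finset.mul_sum, ← h1, hr]
    ring
  · simp only [blockM, Matrix.of_apply, Option.elim, Sum.elim_inl, Sum.elim_inr, map_zero,
      mul_zero, Finset.sum_const_zero, add_zero]
    have h1 := hK2 j a b
    rw [Finset.mul_sum] at h1
    rw [← mul_sub]
    convert h1.symm using 1
    · congr 2
      exact Finset.sum_congr rfl fun c _ => by ring
    · exact Finset.sum_congr rfl fun c _ => by ring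
  · simp only [blockM, Matrix.of_apply, Option.elim, Sum.elim_inl, Sum.elim_inr, map_zero,
      zero_mul, Finset.sum_const_zero, add_zero, map_mul, Complex.conj_ofReal, Complex.conj_conj]
    have h1 := hK1 i a b
    rw [Finset.mul_sum] at h1
    rw [← mul_sub]
    convert h1.symm using 1
    exact Finset.sum_congr rfl fun c _ => by ring
  · simp only [Option.elim, Sum.elim_inl, Sum.elim_inr, map_zero, mul_zero,
      Finset.sum_const_zero, add_zero]
    exact hB (i, a) (j, b)

lemma finite_ext {X : Type*} {s : X → X → ℂ} (hs : IsPosKernel s) (hd : ∀ x, 0 < s x x)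
    (hne : ∀ x y, s x y ≠ 0)
    (hF : ∀ z, IsPosKernel fun x y => 1 - s x z * s z y / (s z z * s x y))
    {N : ℕ} [DecidableEq X] (S : Finset X) (Φ : X → Matrix (Fin N) (Fin N) ℂ)
    (h : (blockM s s (fun i : S => (i : X)) (fun i => Φ i)).PosSemidef) (T : Finset X) :
    ∃ Φ' : X → Matrix (Fin N) (Fin N) ℂ, (∀ x ∈ S, Φ' x = Φ x) ∧
      (blockM s s (fun i : (T ∪ S : Finset X) => (i : X)) (fun i => Φ' i)).PosSemidef := by
  induction T using Finset.induction_on with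
  | empty =>
    refine ⟨Φ, fun _ _ => rfl, ?_⟩
    rw [Finset.empty_union]
    exact h
  | insert z T hz ih =>
    obtain ⟨Φ', h1, h2⟩ := ih
    rw [Finset.insert_union]
    by_cases hzS : z ∈ T ∪ S
    · refine ⟨Φ', h1, ?_⟩
      rw [Finset.insert_eq_of_mem hzS]
      exact h2
    · obtain ⟨A, hA⟩ := one_point hs hd hne z (hF z) _ _ h2
      refine ⟨Function.update Φ' z A, fun x hx => ?_, ?_⟩
      · have : x ≠ z := by
          rintro rfl
          exact hzS (Finset.mem_union_right _ hx)
        rw [Function.update_of_ne this, h1 x hx]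
      · let e : (insert z (T ∪ S) : Finset X) → Option (T ∪ S : Finset X) := fun i =>
          if hi : (i : X) ∈ T ∪ S then some ⟨i, hi⟩ else none
        have he1 : ∀ i, (e i).elim z (fun i : (T ∪ S : Finset X) => (i : X)) = i := by
          intro i
          by_cases hi : (i : X) ∈ T ∪ S
          · simp only [e, hi, dite_true, Option.elim]
          · have : (i : X) = z := (Finset.mem_insert.mp i.2).resolve_right hi
            have hn : e i = none := dif_neg hi
            rw [hn, this]
            rfl
        have he2 : ∀ i, (e i).elim A (fun i : (T ∪ S : Finset X) => Φ' i) =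
            Function.update Φ' z A i := by
          intro i
          by_cases hi : (i : X) ∈ T ∪ S
          · have : (i : X) ≠ z := by
              intro h
              exact hzS (h ▸ hi)
            simp only [e, hi, dite_true, Option.elim, Function.update_of_ne this]
          · have : (i : X) = z := (Finset.mem_insert.mp i.2).resolve_right hi
            have hn : e i = none := dif_neg hi
            rw [hn, this, Function.update_self]
            rfl
        refine psd_congr (hA.submatrix (fun p => (e p.1, p.2))) fun p q => ?_
        simp only [blockM, Matrix.of_apply, Matrix.submatrix_apply, he1, he2]

lemma block_consistent {X : Type*} {s : X → X → ℂ} (hd : ∀ x, 0 < s x x) {n N : ℕ}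
    (z : Fin n → X) (W : Fin n → Matrix (Fin N) (Fin N) ℂ) (h : (blockM s s z W).PosSemidef)
    {i j : Fin n} (hij : z i = z j) : W i = W j := by
  obtain ⟨m, B, hB⟩ := psd_gram h
  ext a c
  have h1 : 0 ≤ ∑ e, (B (i, a) e - B (j, a) e) * (starRingEnd ℂ) (B (i, a) e - B (j, a) e) :=
    Finset.sum_nonneg fun e _ => mul_star_self_nonneg _
  have h2 : ∑ e, (B (i, a) e - B (j, a) e) * (starRingEnd ℂ) (B (i, a) e - B (j, a) e) =
      - (s (z j) (z j) * ∑ c, (W i a c - W j a c) * (starRingEnd ℂ) (W i a c - W j a c)) := by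
    have e1 : ∀ {κ : Type} [Fintype κ] (u v : κ → ℂ),
        ∑ c, (u c - v c) * (starRingEnd ℂ) (u c - v c) =
        ∑ c, u c * (starRingEnd ℂ) (u c) - ∑ c, u c * (starRingEnd ℂ) (v c)
        - ∑ c, v c * (starRingEnd ℂ) (u c) + ∑ c, v c * (starRingEnd ℂ) (v c) := by
      intro κ _ u v
      simp only [← Finset.sum_sub_distrib, ← Finset.sum_add_distrib, map_sub]
      exact Finset.sum_congr rfl fun a _ => by ring
    rw [e1, e1, ← hB, ← hB, ← hB, ← hB]
    simp only [blockM, Matrix.of_apply, hij]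
    simp
    ring
  rw [h2] at h1
  have h3 : 0 ≤ ∑ c, (W i a c - W j a c) * (starRingEnd ℂ) (W i a c - W j a c) :=
    Finset.sum_nonneg fun e _ => mul_star_self_nonneg _
  have h4 : s (z j) (z j) * ∑ c, (W i a c - W j a c) * (starRingEnd ℂ) (W i a c - W j a c) = 0 :=
    le_antisymm (neg_nonneg.mp h1) (mul_nonneg (hd _).le h3)
  have h5 := (mul_eq_zero.mp h4).resolve_left (hd _).ne'
  have h6 := (Finset.sum_eq_zero_iff_of_nonneg (fun e _ => mul_star_self_nonneg _)).mp h5 c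
    (Finset.mem_univ _)
  rw [← starRingEnd_apply, Complex.mul_conj] at h6
  exact sub_eq_zero.mp (Complex.normSq_eq_zero.mp (by exact_mod_cast h6))

/-- McCullough–Quiggin, sufficiency. -/
lemma pick_sufficiency {X : Type*} {s : X → X → ℂ} (hs : IsPosKernel s) (hd : ∀ x, 0 < s x x)
    (hne : ∀ x y, s x y ≠ 0)
    (hF : ∀ z, IsPosKernel fun x y => 1 - s x z * s z y / (s z z * s x y)) :
    IsCompletePickPair s s := by
  classical
  intro n N _ _ z W hW
  rw [pickBlockPSD_iff] at hW
  let S : Finset X := Finset.univ.image z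
  let Φ₀ : X → Matrix (Fin N) (Fin N) ℂ := fun x => if h : ∃ i, z i = x then W h.choose else 0
  have hΦ₀ : ∀ i, Φ₀ (z i) = W i := by
    intro i
    have h : ∃ j, z j = z i := ⟨i, rfl⟩
    simp only [Φ₀, h, dite_true]
    exact block_consistent hd z W hW h.choose_spec
  have hS : ∀ i : S, ∃ j, z j = i := fun i => by
    obtain ⟨j, -, hj⟩ := Finset.mem_image.mp i.2
    exact ⟨j, hj⟩
  choose e he using hS
  have hgood : (blockM s s (fun i : S => (i : X)) (fun i => Φ₀ i)).PosSemidef := by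
    refine psd_congr (hW.submatrix (fun p => (e p.1, p.2))) fun p q => ?_
    simp only [blockM, Matrix.of_apply, Matrix.submatrix_apply, he, ← hΦ₀]
  let I := Σ n : ℕ, (Fin n → X) × (Fin n → Fin N → ℂ)
  let q : I → (X → Fin N → Fin N → ℂ) → ℂ := fun t Ψ =>
    ∑ a : Fin t.1 × Fin N, ∑ b : Fin t.1 × Fin N,
      (starRingEnd ℂ) (t.2.2 a.1 a.2) * t.2.2 b.1 b.2 *
        blockM s s t.2.1 (fun i => Matrix.of (Ψ (t.2.1 i))) a b
  have hq : ∀ t, Continuous (q t) := by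
    intro t
    simp only [q, blockM, Matrix.of_apply]
    fun_prop
  let K : Set (X → Fin N → Fin N → ℂ) :=
    Set.pi Set.univ fun _ => Set.pi Set.univ fun _ => Set.pi Set.univ fun _ =>
      Metric.closedBall (0 : ℂ) 1
  have hK : IsCompact K := isCompact_univ_pi fun _ => isCompact_univ_pi fun _ =>
    isCompact_univ_pi fun _ => isCompact_closedBall _ _
  let C : I → Set (X → Fin N → Fin N → ℂ) := fun t =>
    {Ψ | 0 ≤ q t Ψ} ∩ {Ψ | ∀ i, Ψ (z i) = W i}
  have hC : ∀ t, IsClosed (C t) := by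
    intro t
    refine IsClosed.inter (isClosed_le continuous_const (hq t)) ?_
    simp only [Set.ofPred_forall]
    exact isClosed_iInter fun i => isClosed_eq (continuous_apply _) continuous_const
  obtain ⟨Ψ, hΨK, hΨ⟩ := hK.inter_iInter_nonempty C hC (by
    intro u
    let T : Finset X := u.biUnion fun t => Finset.univ.image t.2.1
    obtain ⟨Φ', h1, h2⟩ := finite_ext hs hd hne hF S Φ₀ hgood T
    refine ⟨fun x a b => if x ∈ T ∪ S then Φ' x a b else 0, ?_, ?_⟩
    · simp only [K, Set.mem_pi, Set.mem_univ, true_imp_iff]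
      intro x a b
      by_cases hx : x ∈ T ∪ S
      · simp only [hx, if_true, mem_closedBall_zero_iff]
        have h3 := h2.diag_nonneg (i := (⟨x, hx⟩, a))
        simp only [blockM, Matrix.of_apply, if_true, mul_one] at h3
        have h4 : s x x * (∑ c, Φ' x a c * (starRingEnd ℂ) (Φ' x a c)) ≤ s x x * 1 := by
          rw [mul_one]; exact sub_nonneg.mp h3
        have h5 := le_of_mul_le_mul_left h4 (hd x)
        have h6 : Φ' x a b * (starRingEnd ℂ) (Φ' x a b) ≤ 1 :=
          (Finset.single_le_sum (f := fun c => Φ' x a c * (starRingEnd ℂ) (Φ' x a c))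
            (fun c _ => mul_star_self_nonneg _) (Finset.mem_univ b)).trans h5
        rw [Complex.mul_conj, Complex.normSq_eq_norm_sq] at h6
        have h7 : ‖Φ' x a b‖ ^ 2 ≤ 1 := by exact_mod_cast h6
        nlinarith [norm_nonneg (Φ' x a b)]
      · simp [hx]
    · simp only [Set.mem_iInter]
      intro t ht
      refine ⟨?_, fun i => ?_⟩
      · have hmem : ∀ i, t.2.1 i ∈ T ∪ S := fun i => Finset.mem_union_left _
          (Finset.mem_biUnion.mpr ⟨t, ht, Finset.mem_image_of_mem _ (Finset.mem_univ _)⟩)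
        refine psd_nonneg (psd_congr (h2.submatrix
          (fun p : Fin t.1 × Fin N => (⟨t.2.1 p.1, hmem p.1⟩, p.2))) fun a b => ?_)
          (fun p => t.2.2 p.1 p.2)
        simp only [blockM, Matrix.of_apply, Matrix.submatrix_apply, hmem, if_true]
      · have hmem : z i ∈ S := Finset.mem_image_of_mem _ (Finset.mem_univ _)
        have hmem' : z i ∈ T ∪ S := Finset.mem_union_right _ hmem
        simp only [hmem', if_true, h1 _ hmem, hΦ₀])
  simp only [Set.mem_iInter] at hΨ
  refine ⟨fun x => Matrix.of (Ψ x), ?_, fun i => ?_⟩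
  · intro m y u
    rw [block_quad]
    exact (hΨ ⟨m, y, u⟩).1
  · have := (hΨ ⟨0, Fin.elim0, Fin.elim0⟩).2 i
    exact congrArg Matrix.of this

section cert
variable {X : Type*} {k ℓ : X → X → ℂ} {p : X → X → X → ℂ}

lemma cert_L (hℓ : IsPosKernel ℓ) (hℓd : ∀ x, 0 < ℓ x x) (hp : IsShimorinCertificate k ℓ p)
    (z : X) : IsPosKernel fun x y => ℓ x y * (1 - p z x y) := by
  have hc : 0 ≤ 1 / ℓ z z := by
    rw [one_div]; exact (RCLike.inv_pos_of_pos (hℓd z)).le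
  refine ((hp z).2.1.add ((IsPosKernel.const hc).mul
    (IsPosKernel.rankOne fun x => ℓ x z))).congr fun x y => ?_
  have e := hℓ.herm y z
  simp only [kerShift, ← e]
  ring

lemma cert_le (hℓ : IsPosKernel ℓ) (hℓd : ∀ x, 0 < ℓ x x) (hp : IsShimorinCertificate k ℓ p)
    (z x : X) : p z x x ≤ 1 := by
  have h1 := (cert_L hℓ hℓd hp z).diag x
  by_contra h2
  have h3 : 0 ≤ 1 - p z x x := by
    have h4 : ℓ x x * 0 ≤ ℓ x x * (1 - p z x x) := by rw [mul_zero]; exact h1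
    exact le_of_mul_le_mul_left h4 (hℓd x)
  exact h2 (sub_nonneg.mp h3)

lemma cert_lt_of_ne (hℓ : IsPosKernel ℓ) (hℓd : ∀ x, 0 < ℓ x x)
    (hp : IsShimorinCertificate k ℓ p) (z x : X) (hx : ℓ x z ≠ 0) : p z x x < 1 := by
  refine lt_of_le_of_ne (cert_le hℓ hℓd hp z x) fun h1 => hx ?_
  have h2 := (hp z).2.1.diag x
  simp only [kerShift, h1, one_mul] at h2
  have h3 : ℓ x z * ℓ z x / ℓ z z ≤ 0 := by
    have : ℓ x x - ℓ x z * ℓ z x / ℓ z z - ℓ x x = - (ℓ x z * ℓ z x / ℓ z z) := by ring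
    rw [this] at h2
    exact neg_nonneg.mp h2
  rw [div_le_iff₀ (hℓd z), zero_mul, hℓ.herm x z] at h3
  have h4 : ℓ x z * (starRingEnd ℂ) (ℓ x z) = 0 := le_antisymm h3 (mul_star_self_nonneg _)
  rw [Complex.mul_conj] at h4
  exact Complex.normSq_eq_zero.mp (by exact_mod_cast h4)

lemma cert_lt (hℓ : IsPosKernel ℓ) (hℓd : ∀ x, 0 < ℓ x x)
    (hex : ∀ x z, ∃ w, ℓ w x ≠ 0 ∧ ℓ w z ≠ 0)
    (hp : IsShimorinCertificate k ℓ p) (z x : X) : p z x x < 1 := by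
  refine lt_of_le_of_ne (cert_le hℓ hℓd hp z x) fun h1 => ?_
  obtain ⟨w, hwx, hwz⟩ := hex x z
  have h2 := cert_lt_of_ne hℓ hℓd hp z w hwz
  have h3 := (cert_L hℓ hℓd hp z).zero_of_diag (x := x) (by simp [h1]) w
  have h4 := (hp z).1.one_sub_ne (x := w) (y := x) h2 h1.le
  have h5 : ℓ x w ≠ 0 := by
    rw [hℓ.herm w x]; simpa using hwx
  have h6 := (mul_eq_zero.mp h3).resolve_left h5
  have h7 := (hp z).1.herm x w
  apply h4
  rw [h7, ← map_one (starRingEnd ℂ), ← map_sub, h6, map_zero]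

lemma cert_ne (hℓ : IsPosKernel ℓ) (hℓd : ∀ x, 0 < ℓ x x) (hkd : ∀ x, 0 < k x x)
    (hex : ∀ x z, ∃ w, ℓ w x ≠ 0 ∧ ℓ w z ≠ 0)
    (hp : IsShimorinCertificate k ℓ p) (z x : X) : k x z ≠ 0 := by
  intro h0
  have h1 := (hp z).2.2.diag x
  simp only [kerShift, h0, zero_mul, zero_div, sub_zero] at h1
  have h2 := cert_lt hℓ hℓd hex hp z x
  have h3 : p z x x * k x x < 1 * k x x := mul_lt_mul_of_pos_right h2 (hkd x)
  rw [one_mul] at h3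
  exact absurd (sub_nonneg.mp h1) (not_le_of_gt h3)

lemma cert_strong [Nonempty X] (hk : IsPosKernel k) (hℓ : IsPosKernel ℓ) (hℓd : ∀ x, 0 < ℓ x x)
    (hkd : ∀ x, 0 < k x x) (hex : ∀ x z, ∃ w, ℓ w x ≠ 0 ∧ ℓ w z ≠ 0)
    (hp : IsShimorinCertificate k ℓ p) : ∃ s, IsStrongShimorinCertificate k ℓ s := by
  obtain ⟨z⟩ := ‹Nonempty X›
  have hkn : ∀ x y, k x y ≠ 0 := fun x y => cert_ne hℓ hℓd hkd hex hp y x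
  have hlt := cert_lt hℓ hℓd hex hp z
  have hL := cert_L hℓ hℓd hp z
  obtain ⟨hP, -, hPk⟩ := hp z
  set P := p z
  have hPn : ∀ x y, 1 - P x y ≠ 0 := fun x y => hP.one_sub_ne (hlt x) (hlt y).le
  have hc : 0 < 1 / k z z := by
    rw [one_div]; exact RCLike.inv_pos_of_pos (hkd z)
  have e : ∀ y, (starRingEnd ℂ) (k y z) = k z y := fun y => (hk.herm y z).symm
  let s : X → X → ℂ := fun x y => k x z * k z y / k z z * (1 - P x y)⁻¹
  have hsn : ∀ x y, s x y ≠ 0 := fun x y =>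
    mul_ne_zero (div_ne_zero (mul_ne_zero (hkn _ _) (hkn _ _)) (hkn _ _)) (inv_ne_zero (hPn _ _))
  have hs : IsPosKernel s := by
    refine ((IsPosKernel.const hc.le).mul ((hP.geom hlt).scale fun x => k x z)).congr fun x y => ?_
    simp only [s, e]
    ring
  have hsd : ∀ x, 0 < s x x := fun x => lt_of_le_of_ne (hs.diag x) (hsn x x).symm
  refine ⟨s, hs, pick_sufficiency hs hsd hsn fun w => ?_,
    fun x y => 1 - k x y / s x y, fun x y => ℓ x y / s x y, ?_, ?_, ?_, ?_⟩
  · have h1 : 0 ≤ 1 - P w w := (sub_pos.mpr (hlt w)).le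
    refine (((hP.mobius (hlt w)).mul (IsPosKernel.const h1)).scale
      fun x => (1 - P x w)⁻¹).congr fun x y => ?_
    have n1 := hkn x z; have n2 := hkn z y; have n3 := hkn w z; have n4 := hkn z w
    have n5 := hkn z z
    have m1 := hPn x w; have m2 := hPn w y; have m3 := hPn w w; have m4 := hPn x y
    have e2 : (starRingEnd ℂ) (1 - P y w)⁻¹ = (1 - P w y)⁻¹ := by
      rw [map_inv₀, map_sub, map_one, ← hP.herm y w]
    simp only [s, e2]
    field_simp
    ring
  · refine (((IsPosKernel.const (hkd z).le).mul hPk).scale fun x => (k x z)⁻¹).congr fun x y => ?_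
    have n1 := hkn x z; have n2 := hkn z y
    have n5 := hkn z z
    have m4 := hPn x y
    simp only [s, kerShift, map_inv₀, e]
    field_simp
    ring
  · refine (((IsPosKernel.const (hkd z).le).mul hL).scale fun x => (k x z)⁻¹).congr fun x y => ?_
    have n1 := hkn x z; have n2 := hkn z y
    have n5 := hkn z z
    have m4 := hPn x y
    simp only [s, map_inv₀, e]
    field_simp
  · intro x y
    have := hsn x y
    field_simp
    ring
  · intro x y
    have := hsn x y
    field_simp

lemma strong_cert [TopologicalSpace X] [PreconnectedSpace X]
    (hk : IsPosKernel k) (hkd : ∀ x, 0 < k x x) (hℓd : ∀ x, 0 < ℓ x x)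
    (hcont : ∀ y, Continuous fun x => k x y)
    {s : X → X → ℂ} (hst : IsStrongShimorinCertificate k ℓ s) :
    ∃ p, IsShimorinCertificate k ℓ p := by
  obtain ⟨hs, hP, h, g, hh, hg, hks, hℓs⟩ := hst
  have hs0 : ∀ x, s x x ≠ 0 := fun x h0 => (hkd x).ne' (by rw [hks, h0, mul_zero])
  have hsd : ∀ x, 0 < s x x := fun x => lt_of_le_of_ne (hs.diag x) (hs0 x).symm
  have hlt : ∀ x, h x x < 1 := by
    intro x
    have h1 := hkd x
    rw [hks] at h1
    have h2 : 0 * s x x < (1 - h x x) * s x x := by rw [zero_mul]; exact h1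
    exact sub_pos.mp (lt_of_mul_lt_mul_right h2 (hsd x).le)
  have hhn : ∀ x y, 1 - h x y ≠ 0 := fun x y => hh.one_sub_ne (hlt x) (hlt y).le
  have hiff : ∀ x y, k x y ≠ 0 ↔ s x y ≠ 0 := fun x y => by
    rw [hks]; simp [hhn x y]
  have hkn : ∀ x y, k x y ≠ 0 := by
    intro x y
    have hclopen : IsClopen {x | k x y ≠ 0} := by
      refine ⟨⟨?_⟩, isOpen_ne_fun (hcont y) continuous_const⟩
      rw [isOpen_iff_mem_nhds]
      intro w hw
      have hw' : k w y = 0 := by simpa using hw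
      have h1 : {v | k v w ≠ 0} ∈ nhds w :=
        (isOpen_ne_fun (hcont w) continuous_const).mem_nhds (hkd w).ne'
      refine Filter.mem_of_superset h1 fun v hv => ?_
      have hv' : k w v ≠ 0 := by
        rw [hk.herm v w]; simpa using hv
      simp only [Set.mem_compl_iff, Set.mem_setOf_eq, not_not]
      by_contra hvy
      exact ((hiff _ _).mpr (pick_trans hs hP hsd ((hiff _ _).mp hv') ((hiff _ _).mp hvy))) hw'
    have huniv := hclopen.eq_univ ⟨y, (hkd y).ne'⟩
    have : x ∈ {x | k x y ≠ 0} := by rw [huniv]; trivial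
    exact this
  have hsn : ∀ x y, s x y ≠ 0 := fun x y => (hiff x y).mp (hkn x y)
  have hgn : ∀ x, g x x ≠ 0 := fun x h0 => (hℓd x).ne' (by rw [hℓs, h0, mul_zero])
  refine ⟨fun z x y => 1 - s x z * s z y / (s z z * s x y), fun z =>
    ⟨pick_necessity hs hP hsd hsn z, ?_, ?_⟩⟩
  all_goals
    have hc : 0 ≤ 1 / s z z := by
      rw [one_div]; exact (RCLike.inv_pos_of_pos (hsd z)).le
  · refine (((IsPosKernel.const hc).mul (hg.kerShift z)).scale fun x => s x z).congr fun x y => ?_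
    have n1 := hsn x y; have n2 := hsn z z; have n3 := hgn z
    simp only [kerShift, hℓs, ← hs.herm y z]
    field_simp
    ring
  · refine (((IsPosKernel.const hc).mul (hh.mobius (hlt z))).scale fun x => s x z).congr
      fun x y => ?_
    have n1 := hsn x y; have n2 := hsn z z; have n3 := hhn z z
    simp only [kerShift, hks, ← hs.herm y z]
    field_simp
    ring

end cert

/-- For holomorphic kernels `k, ℓ` on a domain `Ω ⊆ ℂ^𝗀` that are not identically zero,
`(k, ℓ)` has a Shimorin certificate iff it has a strong one, in which case `k` is
non-vanishing on `Ω × Ω`. -/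
theorem holomorphic_certificate_equivalence {g : ℕ} (hg : 1 ≤ g)
    (Ω : Set (Fin g → ℂ)) (hΩo : IsOpen Ω) (hΩc : IsConnected Ω)
    (k ℓ : (Fin g → ℂ) → (Fin g → ℂ) → ℂ)
    (hkhol₁ : ∀ w ∈ Ω, AnalyticOnNhd ℂ (fun z => k z w) Ω)
    (hkhol₂ : ∀ z ∈ Ω, AnalyticOnNhd ℂ (fun w => (starRingEnd ℂ) (k z w)) Ω)
    (hℓhol₁ : ∀ w ∈ Ω, AnalyticOnNhd ℂ (fun z => ℓ z w) Ω)
    (hℓhol₂ : ∀ z ∈ Ω, AnalyticOnNhd ℂ (fun w => (starRingEnd ℂ) (ℓ z w)) Ω)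
    (hkpos : IsPosKernel (fun z w : Ω => k ↑z ↑w))
    (hℓpos : IsPosKernel (fun z w : Ω => ℓ ↑z ↑w))
    (hkd : ∀ x : Ω, 0 < k ↑x ↑x) (hℓd : ∀ x : Ω, 0 < ℓ ↑x ↑x)
    (hkne : ∃ z ∈ Ω, ∃ w ∈ Ω, k z w ≠ 0)
    (hℓne : ∃ z ∈ Ω, ∃ w ∈ Ω, ℓ z w ≠ 0) :
    ((∃ p, IsShimorinCertificate (fun z w : Ω => k ↑z ↑w) (fun z w : Ω => ℓ ↑z ↑w) p) ↔
      ∃ s, IsStrongShimorinCertificate (fun z w : Ω => k ↑z ↑w) (fun z w : Ω => ℓ ↑z ↑w) s) ∧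
    ((∃ p, IsShimorinCertificate (fun z w : Ω => k ↑z ↑w) (fun z w : Ω => ℓ ↑z ↑w) p) →
      ∀ z ∈ Ω, ∀ w ∈ Ω, k z w ≠ 0) := by
  have hcont : ∀ y : Ω, Continuous fun x : Ω => k ↑x ↑y := fun y =>
    continuousOn_iff_continuous_restrict.mp (hkhol₁ y y.2).continuousOn
  have hconn : PreconnectedSpace Ω := isPreconnected_iff_preconnectedSpace.mp hΩc.isPreconnected
  have hnon : Nonempty Ω := hΩc.nonempty.to_subtype
  have hex : ∀ x z : Ω, ∃ w : Ω, ℓ ↑w ↑x ≠ 0 ∧ ℓ ↑w ↑z ≠ 0 := by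
    intro x z
    by_contra hcon
    push Not at hcon
    have h1 : ∀ᶠ w in nhds (x : Fin g → ℂ), ℓ w ↑x ≠ 0 :=
      (hℓhol₁ x x.2 x x.2).continuousAt.eventually_ne (hℓd x).ne'
    have h2 : (fun w => ℓ w ↑z) =ᶠ[nhds (x : Fin g → ℂ)] 0 := by
      filter_upwards [h1, hΩo.mem_nhds x.2] with w hw hwΩ
      exact hcon ⟨w, hwΩ⟩ hw
    exact (hℓd z).ne' ((hℓhol₁ z z.2).eqOn_zero_of_preconnected_of_eventuallyEq_zero
      hΩc.isPreconnected x.2 h2 z.2)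
  refine ⟨⟨?_, ?_⟩, ?_⟩
  · rintro ⟨p, hp⟩
    exact cert_strong hkpos hℓpos hℓd hkd hex hp
  · rintro ⟨s, hs⟩
    exact strong_cert hkpos hkd hℓd hcont hs
  · rintro ⟨p, hp⟩ z hz w hw
    exact cert_ne hℓpos hℓd hkd hex hp ⟨w, hw⟩ ⟨z, hz⟩
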